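/- Let q ≥ 2 and let A be a real q×q matrix that is Metzler (all off-diagonal entries nonnegative) and irreducible, and suppose h_eq ∈ ℝ^q is a nonzero vector with all components nonnegative satisfying A h_eq = 0. Define G = (I_q − h_eq 1_qᵀ / ⟨1_q, h_eq⟩) A and the (q−1)×(q−1) real matrix Ḡ by Ḡ_{ij} = G_{ij} − G_{iq} for all i, j ∈ {1,…,q−1}. Then Ḡ is stable, i.e., every complex eigenvalue of Ḡ has strictly negative real part. -/

import Mathlib

lemma aux_pos {q : ℕ} (A : Matrix (Fin q) (Fin q) ℝ)
    (hMetzler : ∀ i j : Fin q, i ≠ j → 0 ≤ A i j)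
    (hIrred : ∀ S : Set (Fin q), S.Nonempty → S ≠ Set.univ →
      ∃ i ∈ S, ∃ j, j ∉ S ∧ A i j ≠ 0)
    (v : Fin q → ℝ) (hne : v ≠ 0) (hnn : ∀ i, 0 ≤ v i)
    (hnull : ∀ i, ∑ j, A i j * v j = 0) : ∀ i, 0 < v i := by
  by_contra! hcon
  obtain ⟨k, hk⟩ := hcon
  have hk0 : v k = 0 := le_antisymm hk (hnn k)
  obtain ⟨i, hi, j, hj, hA⟩ := hIrred {i | v i = 0} ⟨k, hk0⟩ (by
    intro h
    apply hne
    funext i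
    have : i ∈ {i | v i = 0} := h ▸ Set.mem_univ i
    exact this)
  have hi : v i = 0 := hi
  have hj : v j ≠ 0 := hj
  have hnon : ∀ l ∈ Finset.univ, 0 ≤ A i l * v l := by
    intro l _
    by_cases h : i = l
    · subst h; simp [hi]
    · exact mul_nonneg (hMetzler i l h) (hnn l)
  have := (Finset.sum_eq_zero_iff_of_nonneg hnon).1 (hnull i) j (Finset.mem_univ j)
  exact (mul_ne_zero hA hj) this

/-- The common part: `r ≥ 0` and a nonnegative shift touching zero. -/
lemma aux_shift {q : ℕ} (hq : 0 < q) (A : Matrix (Fin q) (Fin q) ℝ)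
    (hMetzler : ∀ i j : Fin q, i ≠ j → 0 ≤ A i j)
    (h : Fin q → ℝ) (hpos : ∀ i, 0 < h i)
    (hnull : ∀ i, ∑ j, A i j * h j = 0)
    (u : Fin q → ℝ) (r : ℝ) (hu : ∀ i, ∑ j, A i j * u j = r * h i) :
    0 ≤ r ∧ ∃ t : ℝ, (∀ i, 0 ≤ u i - t * h i) ∧ (∃ i, u i - t * h i = 0) ∧
      ∀ i, ∑ j, A i j * (u j - t * h j) = r * h i := by
  haveI : Nonempty (Fin q) := ⟨⟨0, hq⟩⟩
  obtain ⟨i, hi⟩ := Finite.exists_min (fun i => u i / h i)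
  have h0 : u i - u i / h i * h i = 0 := by
    rw [div_mul_cancel₀ _ (hpos i).ne']; ring
  have hv : ∀ j, 0 ≤ u j - u i / h i * h j := by
    intro j
    have := (le_div_iff₀ (hpos j)).1 (hi j)
    linarith
  have hs : ∀ k, ∑ j, A k j * (u j - u i / h i * h j) = r * h k := by
    intro k
    have : ∀ j, A k j * (u j - u i / h i * h j)
        = A k j * u j - u i / h i * (A k j * h j) := fun j => by ring
    simp only [this]
    rw [Finset.sum_sub_distrib, ← Finset.mul_sum, hu, hnull]; ring
  refine ⟨?_, _, hv, ⟨i, h0⟩, hs⟩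
  have h1 : 0 ≤ r * h i := by
    rw [← hs i]
    apply Finset.sum_nonneg
    intro l _
    by_cases e : i = l
    · subst e; rw [h0]; simp
    · exact mul_nonneg (hMetzler i l e) (hv l)
  exact nonneg_of_mul_nonneg_left h1 (hpos i)

lemma aux_zero {q : ℕ} (hq : 0 < q) (A : Matrix (Fin q) (Fin q) ℝ)
    (hMetzler : ∀ i j : Fin q, i ≠ j → 0 ≤ A i j)
    (hIrred : ∀ S : Set (Fin q), S.Nonempty → S ≠ Set.univ →
      ∃ i ∈ S, ∃ j, j ∉ S ∧ A i j ≠ 0)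
    (h : Fin q → ℝ) (hpos : ∀ i, 0 < h i)
    (hnull : ∀ i, ∑ j, A i j * h j = 0)
    (u : Fin q → ℝ) (r : ℝ) (hu : ∀ i, ∑ j, A i j * u j = r * h i)
    (hsum : ∑ i, u i = 0) : ∀ i, u i = 0 := by
  haveI : Nonempty (Fin q) := ⟨⟨0, hq⟩⟩
  obtain ⟨hr, t, hv, ⟨k, hk⟩, hs⟩ := aux_shift hq A hMetzler h hpos hnull u r hu
  have hr' := (aux_shift hq A hMetzler h hpos hnull (fun i => - u i) (-r) (by
    intro i; simp [hu])).1
  have hr0 : r = 0 := by linarith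
  have hv0 : (fun i => u i - t * h i) = 0 := by
    by_contra hne
    have := aux_pos A hMetzler hIrred _ hne hv (by intro i; rw [hs, hr0]; ring) k
    linarith
  have hut : ∀ i, u i = t * h i := fun i => by
    have := congrFun hv0 i
    simp only [Pi.zero_apply] at this
    linarith
  simp only [hut] at hsum
  rw [← Finset.mul_sum] at hsum
  have hp : 0 < ∑ i, h i := Finset.sum_pos (fun i _ => hpos i) Finset.univ_nonempty
  have ht : t = 0 := by
    rcases mul_eq_zero.1 hsum with h | h
    · exact h
    · linarith
  intro i; rw [hut, ht]; ring

lemma aux_eig {q : ℕ} (A : Matrix (Fin q) (Fin q) ℝ)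
    (hMetzler : ∀ i j : Fin q, i ≠ j → 0 ≤ A i j)
    (h : Fin q → ℝ) (hpos : ∀ i, 0 < h i)
    (hnull : ∀ i, ∑ j, A i j * h j = 0)
    (w : Fin q → ℂ) (hw : w ≠ 0) (z : ℂ) (hz : z ≠ 0)
    (hwz : ∀ i, ∑ j, (A i j : ℂ) * w j = z * w i) : z.re < 0 := by
  obtain ⟨k, hk⟩ := Function.ne_iff.1 hw
  haveI : Nonempty (Fin q) := ⟨k⟩
  obtain ⟨i, hi⟩ := Finite.exists_max (fun i => ‖w i‖ / h i)
  have hM : 0 < ‖w i‖ / h i :=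
    lt_of_lt_of_le (div_pos (norm_pos_iff.2 hk) (hpos k)) (hi k)
  have hwi : 0 < ‖w i‖ := by
    have := mul_pos hM (hpos i)
    rwa [div_mul_cancel₀ _ (hpos i).ne'] at this
  have hj : ∀ j, ‖w j‖ ≤ ‖w i‖ / h i * h j := fun j =>
    (div_le_iff₀ (hpos j)).1 (hi j)
  have e1 : (z - A i i) * w i = ∑ j ∈ Finset.univ.erase i, (A i j : ℂ) * w j := by
    have := hwz i
    rw [← Finset.add_sum_erase _ _ (Finset.mem_univ i)] at this
    linear_combination -this
  have e2 : ∑ j ∈ Finset.univ.erase i, A i j * h j = - A i i * h i := by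
    have := hnull i
    rw [← Finset.add_sum_erase _ _ (Finset.mem_univ i)] at this
    linarith
  have e3 : ‖z - A i i‖ * ‖w i‖ ≤ -A i i * ‖w i‖ := by
    rw [← norm_mul, e1]
    calc _ ≤ ∑ j ∈ Finset.univ.erase i, ‖(A i j : ℂ) * w j‖ := norm_sum_le _ _
      _ ≤ ∑ j ∈ Finset.univ.erase i, ‖w i‖ / h i * (A i j * h j) := by
        apply Finset.sum_le_sum
        intro j hj'
        have hA := hMetzler i j (Finset.ne_of_mem_erase hj').symm
        rw [norm_mul, Complex.norm_real, Real.norm_of_nonneg hA]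
        calc _ ≤ A i j * (‖w i‖ / h i * h j) := mul_le_mul_of_nonneg_left (hj j) hA
          _ = _ := by ring
      _ = ‖w i‖ / h i * (- A i i * h i) := by rw [← Finset.mul_sum, e2]
      _ = _ := by
        have := (hpos i).ne'
        field_simp
  have e4 : ‖z - A i i‖ ≤ -A i i := le_of_mul_le_mul_right e3 hwi
  have e5 : ‖z - A i i‖ ^ 2 ≤ (-A i i) ^ 2 := pow_le_pow_left₀ (norm_nonneg _) e4 2
  rw [Complex.sq_norm, Complex.normSq_apply] at e5
  simp only [Complex.sub_re, Complex.sub_im, Complex.ofReal_re, Complex.ofReal_im] at e5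
  have ha : A i i ≤ 0 := by linarith [norm_nonneg (z - A i i)]
  by_contra! hre
  apply hz
  have h1 : z.re * z.re + z.im * z.im ≤ 0 := by nlinarith [mul_nonneg hre (neg_nonneg.2 ha)]
  apply Complex.ext
  · simp; nlinarith [mul_self_nonneg z.re, mul_self_nonneg z.im]
  · simp; nlinarith [mul_self_nonneg z.re, mul_self_nonneg z.im]

lemma aux_main {q : ℕ} (hq : 0 < q) (A : Matrix (Fin q) (Fin q) ℝ)
    (hMetzler : ∀ i j : Fin q, i ≠ j → 0 ≤ A i j)
    (hIrred : ∀ S : Set (Fin q), S.Nonempty → S ≠ Set.univ →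
      ∃ i ∈ S, ∃ j, j ∉ S ∧ A i j ≠ 0)
    (h : Fin q → ℝ) (hpos : ∀ i, 0 < h i)
    (hnull : ∀ i, ∑ j, A i j * h j = 0)
    (y : Fin q → ℂ) (hy : y ≠ 0) (hsum : ∑ i, y i = 0) (z c : ℂ)
    (hyz : ∀ i, ∑ j, (A i j : ℂ) * y j = z * y i + c * h i) : z.re < 0 := by
  haveI : Nonempty (Fin q) := ⟨⟨0, hq⟩⟩
  have hp : 0 < ∑ i, h i := Finset.sum_pos (fun i _ => hpos i) Finset.univ_nonempty
  have hnullC : ∀ i, ∑ j, (A i j : ℂ) * (h j : ℂ) = 0 := fun i => by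
    exact_mod_cast hnull i
  by_cases hz : z = 0
  · exfalso
    subst hz
    apply hy
    have hre := aux_zero hq A hMetzler hIrred h hpos hnull (fun i => (y i).re) c.re
      (fun i => by simpa using congrArg Complex.re (hyz i))
      (by simpa using congrArg Complex.re hsum)
    have him := aux_zero hq A hMetzler hIrred h hpos hnull (fun i => (y i).im) c.im
      (fun i => by simpa using congrArg Complex.im (hyz i))
      (by simpa using congrArg Complex.im hsum)
    funext i
    exact Complex.ext (hre i) (him i)
  · refine aux_eig A hMetzler h hpos hnull (fun i => y i + c / z * h i) ?_ z hz ?_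
    · intro h0
      have h1 : ∀ i, y i = - (c / z) * h i := fun i => by
        have := congrFun h0 i
        simp only [Pi.zero_apply] at this
        linear_combination this
      have h2 := hsum
      simp only [h1] at h2
      rw [← Finset.mul_sum] at h2
      have h3 : (∑ i, (h i : ℂ)) ≠ 0 := by exact_mod_cast hp.ne'
      have h4 := (mul_eq_zero.1 h2).resolve_right h3
      apply hy
      funext i
      rw [h1, h4]; simp
    · intro i
      have : ∀ j, (A i j : ℂ) * (y j + c / z * h j)
        = A i j * y j + c / z * (A i j * h j) := fun j => by ring
      simp only [this]
      rw [Finset.sum_add_distrib, ← Finset.mul_sum, hyz, hnullC]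
      field_simp
      ring

lemma aux_final (n : ℕ) (A : Matrix (Fin (n+1)) (Fin (n+1)) ℝ)
    (hMetzler : ∀ i j : Fin (n+1), i ≠ j → 0 ≤ A i j)
    (hIrred : ∀ S : Set (Fin (n+1)), S.Nonempty → S ≠ Set.univ →
      ∃ i ∈ S, ∃ j, j ∉ S ∧ A i j ≠ 0)
    (heq : Fin (n+1) → ℝ) (hne : heq ≠ 0) (hnn : ∀ i, 0 ≤ heq i)
    (hnull : A.mulVec heq = 0)
    (G : Matrix (Fin (n+1)) (Fin (n+1)) ℝ)
    (hG : G = ((1 : Matrix (Fin (n+1)) (Fin (n+1)) ℝ) -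
      (∑ i, heq i)⁻¹ • Matrix.vecMulVec heq (fun _ => (1 : ℝ))) * A)
    (Gbar : Matrix (Fin n) (Fin n) ℝ)
    (hGbar : ∀ i j, Gbar i j = G i.castSucc j.castSucc - G i.castSucc (Fin.last n)) :
    ∀ z : ℂ, (Matrix.charpoly (Gbar.map Complex.ofReal)).IsRoot z → z.re < 0 := by
  intro z hz
  have hnull' : ∀ i, ∑ j, A i j * heq j = 0 := fun i => congrFun hnull i
  have hpos := aux_pos A hMetzler hIrred heq hne hnn hnull'
  have hp : 0 < ∑ i, heq i := Finset.sum_pos (fun i _ => hpos i) Finset.univ_nonempty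
  have hGe : ∀ i j, G i j = A i j - (∑ i, heq i)⁻¹ * heq i * ∑ k, A k j := by
    intro i j
    rw [hG, Matrix.sub_mul, Matrix.sub_apply, Matrix.one_mul, Matrix.smul_mul,
      Matrix.smul_apply, Matrix.mul_apply]
    simp [Matrix.vecMulVec_apply, Finset.mul_sum, mul_assoc]
  have hGcol : ∀ j, ∑ i, G i j = 0 := by
    intro j
    simp only [hGe]
    rw [Finset.sum_sub_distrib, ← Finset.sum_mul, ← Finset.mul_sum,
      inv_mul_cancel₀ hp.ne']
    ring
  rw [Polynomial.IsRoot, Matrix.eval_charpoly] at hz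
  obtain ⟨x, hx, hxz⟩ := Matrix.exists_mulVec_eq_zero_iff.2 hz
  have hxz' : ∀ i, ∑ j, (Gbar i j : ℂ) * x j = z * x i := by
    intro i
    have := congrFun hxz i
    rw [Matrix.sub_mulVec] at this
    simp [Matrix.mulVec, dotProduct, Matrix.diagonal_apply, sub_eq_zero] at this
    exact this.symm
  let y : Fin (n+1) → ℂ := Fin.snoc (α := fun _ => ℂ) x (-∑ i, x i)
  have y1 : ∀ i : Fin n, y i.castSucc = x i := fun i => by simp [y]
  have y2 : y (Fin.last n) = -∑ i, x i := by simp [y]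
  have hsum : ∑ i, y i = 0 := by
    rw [Fin.sum_univ_castSucc, y2]; simp [y1]
  have hGy1 : ∀ i : Fin n, ∑ j, (G i.castSucc j : ℂ) * y j = z * y i.castSucc := by
    intro i
    rw [y1, ← hxz', Fin.sum_univ_castSucc, y2]
    simp only [y1, hGbar, Complex.ofReal_sub, sub_mul, Finset.sum_sub_distrib]
    rw [← Finset.mul_sum]; ring
  have hGtot : ∑ i, ∑ j, (G i j : ℂ) * y j = 0 := by
    rw [Finset.sum_comm]
    apply Finset.sum_eq_zero
    intro j _
    rw [← Finset.sum_mul]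
    have : ∑ i, (G i j : ℂ) = 0 := by exact_mod_cast hGcol j
    rw [this, zero_mul]
  have hGy : ∀ i, ∑ j, (G i j : ℂ) * y j = z * y i := by
    intro i
    refine Fin.lastCases ?_ hGy1 i
    rw [Fin.sum_univ_castSucc] at hGtot
    simp only [hGy1] at hGtot
    rw [← Finset.mul_sum] at hGtot
    rw [Fin.sum_univ_castSucc] at hsum
    linear_combination hGtot - z * hsum
  refine aux_main (Nat.succ_pos n) A hMetzler hIrred heq hpos hnull' y ?_ hsum z
    (((∑ i, heq i : ℝ) : ℂ)⁻¹ * ∑ j, (∑ k, (A k j : ℂ)) * y j) ?_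
  · intro h0
    apply hx
    funext i
    rw [← y1, h0]; rfl
  · intro i
    rw [← hGy i]
    simp only [hGe]
    rw [mul_right_comm, Finset.mul_sum, ← Finset.sum_add_distrib]
    apply Finset.sum_congr rfl
    intro j _
    push_cast
    ring


/-- Let `A` be an irreducible Metzler matrix, `q ≥ 2`, and `h_eq` a
nonzero nonnegative vector with `A h_eq = 0`.  With
`G = (I − h_eq 1ᵀ / ⟨1, h_eq⟩) A` and `Ḡ_{ij} = G_{ij} − G_{iq}` for
`i, j ∈ {1,…,q−1}`, the matrix `Ḡ` is stable: all its complex eigenvalues have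
strictly negative real part. -/
theorem stmt_4 (q : ℕ) (hq : 2 ≤ q) (A : Matrix (Fin q) (Fin q) ℝ)
    (hMetzler : ∀ i j : Fin q, i ≠ j → 0 ≤ A i j)
    (hIrred : ∀ S : Set (Fin q), S.Nonempty → S ≠ Set.univ →
      ∃ i ∈ S, ∃ j, j ∉ S ∧ A i j ≠ 0)
    (heq : Fin q → ℝ) (hne : heq ≠ 0) (hnn : ∀ i, 0 ≤ heq i)
    (hnull : A.mulVec heq = 0)
    (G : Matrix (Fin q) (Fin q) ℝ)
    (hG : G = ((1 : Matrix (Fin q) (Fin q) ℝ) -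
      (∑ i, heq i)⁻¹ • Matrix.vecMulVec heq (fun _ => (1 : ℝ))) * A)
    (Gbar : Matrix (Fin (q - 1)) (Fin (q - 1)) ℝ)
    (hGbar : Gbar = Matrix.of fun i j : Fin (q - 1) =>
      G (Fin.castLE (Nat.sub_le q 1) i) (Fin.castLE (Nat.sub_le q 1) j)
        - G (Fin.castLE (Nat.sub_le q 1) i) ⟨q - 1, by omega⟩) :
    ∀ z : ℂ, (Matrix.charpoly (Gbar.map Complex.ofReal)).IsRoot z → z.re < 0 := by
  obtain ⟨n, rfl⟩ : ∃ n, q = n + 1 := ⟨q - 1, by omega⟩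
  exact aux_final n A hMetzler hIrred heq hne hnn hnull G hG Gbar
    (fun i j => by rw [hGbar]; rfl)
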